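/- arXiv:1206.2973 — 2 statements merged into one kernel-verified Lean document; each statement's English description precedes it below -/
import Mathlib

section
/- Let V be a finite set of vertices and let adj be a symmetric relation on V (so vertices may be related to themselves, modeling loops; there is at most one edge between any two vertices). Then there exists a subset S ⊆ V (the set of vertices to click) such that for every vertex v ∈ V, the number of vertices u ∈ S with adj u v is odd if and only if adj v v holds. Equivalently, starting with all vertices in state 0 and toggling, for each clicked vertex, the states of all vertices adjacent to it, one can reach the state in which exactly the vertices connected to themselves have state 1 and all other vertices have state 0. -/
/-- Over a commutative ring of characteristic two, the quadratic form of a symmetric matrix only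
sees the diagonal. -/
theorem Matrix.IsSymm.dotProduct_mulVec_self_of_charTwo {n R : Type*} [Fintype n] [CommRing R]
    [CharP R 2] {A : Matrix n n R} (hA : A.IsSymm) (x : n → R) :
    x ⬝ᵥ A.mulVec x = ∑ i, A i i * x i ^ 2 := by
  classical
  have off_diag : ∑ p ∈ (Finset.univ : Finset n).offDiag, x p.1 * (A p.1 p.2 * x p.2) = 0 := by
    refine Finset.sum_involution (fun p _ => p.swap) ?_ ?_ ?_ ?_
    · rintro ⟨i, j⟩ _
      have : x j * (A j i * x i) = x i * (A i j * x j) := by rw [hA.apply i j]; ring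
      simp [this, CharTwo.add_self_eq_zero]
    · rintro ⟨i, j⟩ hij _ h
      simp only [Prod.swap_prod_mk, Prod.mk.injEq] at h
      simp [h.1] at hij
    · rintro ⟨i, j⟩ hij
      simpa [eq_comm] using hij
    · simp
  simp only [dotProduct, Matrix.mulVec, Finset.mul_sum]
  rw [← Finset.sum_product', ← Finset.diag_union_offDiag,
    Finset.sum_union (Finset.disjoint_diag_offDiag _), off_diag, add_zero, Finset.sum_diag]
  exact Finset.sum_congr rfl fun i _ => by ring

/-- The diagonal of a symmetric matrix over `𝔽₂` lies in its column space. -/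
theorem Matrix.IsSymm.exists_mulVec_eq_diag {n : Type*} [Fintype n] {A : Matrix n n (ZMod 2)}
    (hA : A.IsSymm) : ∃ x, A.mulVec x = A.diag := by
  classical
  by_contra h
  have hdiag : A.diag ∉ LinearMap.range A.mulVecLin := by simpa using h
  obtain ⟨f, hf, hker⟩ := Submodule.exists_le_ker_of_notMem hdiag
  obtain ⟨y, rfl⟩ := (dotProductEquiv (ZMod 2) n).surjective f
  have hy : y ⬝ᵥ A.mulVec y = 0 := hker ⟨y, rfl⟩
  rw [hA.dotProduct_mulVec_self_of_charTwo] at hy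
  apply hf
  rw [dotProductEquiv_apply_apply, ← hy]
  exact Finset.sum_congr rfl fun i _ => by rw [ZMod.pow_card, Matrix.diag_apply, mul_comm]

theorem lights_out_loops (V : Type*) [Fintype V] (adj : V → V → Prop)
    [DecidableRel adj] (hsymm : Symmetric adj) :
    ∃ S : Finset V, ∀ v : V,
      (Odd (S.filter (fun u => adj u v)).card ↔ adj v v) := by
  have hcomm (u v : V) : adj u v ↔ adj v u := ⟨fun h => hsymm h, fun h => hsymm h⟩
  let A : Matrix V V (ZMod 2) := Matrix.of fun u v => if adj u v then 1 else 0
  have hA : A.IsSymm := Matrix.IsSymm.ext fun u v => by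
    simp only [A, Matrix.of_apply, hcomm u v]
  obtain ⟨x, hx⟩ := hA.exists_mulVec_eq_diag
  refine ⟨Finset.univ.filter fun u => x u = 1, fun v => ?_⟩
  have hcard : (((Finset.univ.filter fun u => x u = 1).filter fun u => adj u v).card : ZMod 2)
      = A.mulVec x v := by
    rw [Finset.card_filter, Finset.sum_filter, Nat.cast_sum]
    refine Finset.sum_congr rfl fun u _ => ?_
    have hbit : ∀ b : ZMod 2, b = if b = 1 then 1 else 0 := by decide
    rw [hbit (x u)]
    by_cases h1 : x u = 1 <;> simp [A, h1, hcomm v u]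
  rw [← ZMod.natCast_eq_one_iff_odd, hcard, hx]
  simp [A]
end

section
/- Let V be a finite set of vertices and let adj be a symmetric and reflexive relation on V (every vertex is connected to itself, modeling the rule that clicking a vertex toggles its own state as well as the states of its neighbors). Then there exists a subset S ⊆ V such that for every vertex v ∈ V, the number of vertices u ∈ S with adj u v is odd. Equivalently, starting from the state where all vertices are 0 (all lights off), one can click a set of vertices so that every vertex ends in state 1 (all lights on). -/
open Matrix in
/-- The quadratic form of a symmetric matrix over `ZMod 2` is the linear form of its diagonal. -/
theorem Matrix.IsSymm.dotProduct_mulVec_self_zmod_two {V : Type*} [Fintype V]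
    {A : Matrix V V (ZMod 2)} (hA : A.IsSymm) (w : V → ZMod 2) :
    w ⬝ᵥ A *ᵥ w = w ⬝ᵥ A.diag := by
  classical
  have offDiag_sum : ∑ p ∈ (Finset.univ : Finset V).offDiag, w p.1 * (A p.1 p.2 * w p.2) = 0 := by
    refine Finset.sum_involution (fun p _ => p.swap) ?_ ?_ ?_ ?_
    · intro p _
      have key : w p.2 * (A p.2 p.1 * w p.1) = w p.1 * (A p.1 p.2 * w p.2) := by
        rw [hA.apply]
        ring
      exact (congrArg _ key).trans (CharTwo.add_self_eq_zero _)
    · intro p hp _ h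
      exact (Finset.mem_offDiag.mp hp).2.2 (congrArg Prod.snd h)
    · simp [eq_comm]
    · simp
  have idempotent : ∀ a b : ZMod 2, a * (b * a) = a * b := by decide
  simp only [dotProduct, mulVec, Finset.mul_sum]
  rw [← Finset.sum_product', ← Finset.diag_union_offDiag,
    Finset.sum_union (Finset.disjoint_diag_offDiag _), offDiag_sum, add_zero, Finset.sum_diag]
  simp [idempotent]

open Matrix in
/-- The diagonal of a symmetric matrix over `ZMod 2` lies in its column space. -/
theorem Matrix.IsSymm.exists_mulVec_eq_diag_zmod_two {V : Type*} [Fintype V]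
    {A : Matrix V V (ZMod 2)} (hA : A.IsSymm) : ∃ x, A *ᵥ x = A.diag := by
  classical
  by_contra h
  have notMem : A.diag ∉ LinearMap.range A.mulVecLin := h
  obtain ⟨f, hf, hrange⟩ := Submodule.exists_dual_map_eq_bot_of_notMem notMem inferInstance
  obtain ⟨w, rfl⟩ := (dotProductEquiv (ZMod 2) V).surjective f
  apply hf
  have hw : dotProductEquiv (ZMod 2) V w (A *ᵥ w) = 0 := by
    rw [← Submodule.mem_bot (ZMod 2), ← hrange]
    exact Submodule.mem_map_of_mem (LinearMap.mem_range_self A.mulVecLin w)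
  simpa [hA.dotProduct_mulVec_self_zmod_two] using hw

theorem lights_out_all_on (V : Type*) [Fintype V] (adj : V → V → Prop)
    [DecidableRel adj] (hsymm : Symmetric adj) (hrefl : Reflexive adj) :
    ∃ S : Finset V, ∀ v : V, Odd (S.filter (fun u => adj u v)).card := by
  let A : Matrix V V (ZMod 2) := Matrix.of fun v u => if adj u v then 1 else 0
  have hA : A.IsSymm := Matrix.IsSymm.ext fun u v => by
    simp only [A, Matrix.of_apply, (⟨@hsymm u v, @hsymm v u⟩ : adj u v ↔ adj v u)]
  obtain ⟨x, hx⟩ := hA.exists_mulVec_eq_diag_zmod_two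
  refine ⟨Finset.univ.filter fun u => x u = 1, fun v => ?_⟩
  have indicator : ∀ a : ZMod 2, (if a = 1 then 1 else 0) = a := by decide
  rw [← ZMod.natCast_eq_one_iff_odd, Finset.filter_filter, Finset.card_filter]
  have hv := congrFun hx v
  simp only [A, Matrix.mulVec, dotProduct, Matrix.of_apply, Matrix.diag_apply, hrefl v,
    if_true] at hv
  push_cast
  refine Eq.trans ?_ hv
  refine Finset.sum_congr rfl fun u _ => ?_
  by_cases h : adj u v <;> simp [h, indicator]
end
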